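/- Let X, Y, A be small categories and let v : X ⥤ A, w : Y ⥤ A, u : X ⥤ Y be functors with w ∘ u = v. For each object a of A, let u/a : v↓a → w↓a be the induced functor between comma categories, sending (x, p : v(x) → a) to (u(x), p). If u/a is an equivalence of categories for every object a of A, then u is an equivalence of categories. -/

import Mathlib

open CategoryTheory

universe u

variable {X Y A : Type u} [Category.{u} X] [Category.{u} Y] [Category.{u} A]

/-- Given functors `v : X ⥤ A`, `w : Y ⥤ A`, `u : X ⥤ Y` with `w ∘ u = v`, and an object
`a : A`, the induced functor `u/a : v↓a ⥤ w↓a` between comma categories, sending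
`(x, p : v(x) ⟶ a)` to `(u(x), p)`. -/
@[simps]
def inducedSliceFunctor (v : X ⥤ A) (w : Y ⥤ A) (u : X ⥤ Y) (h : u ⋙ w = v) (a : A) :
    CostructuredArrow v a ⥤ CostructuredArrow w a where
  obj o := CostructuredArrow.mk (Y := u.obj o.left)
    (eqToHom (Functor.congr_obj h o.left) ≫ o.hom)
  map {o o'} f := CostructuredArrow.homMk (u.map f.left) (by
    have hw := CostructuredArrow.w f
    have hc := Functor.congr_hom h f.left
    simp only [Functor.comp_map] at hc
    simp [hc, hw])

/-- "Folk Theorem A" for 1-categories: given a commutative triangle of functors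
`w ∘ u = v` over `A`, if the induced functor `u/a : v↓a ⥤ w↓a` is an equivalence of
categories for every object `a` of `A`, then `u` is an equivalence of categories. -/
theorem isEquivalence_of_slices_isEquivalence
    (v : X ⥤ A) (w : Y ⥤ A) (u : X ⥤ Y) (h : u ⋙ w = v)
    (he : ∀ a : A, (inducedSliceFunctor v w u h a).IsEquivalence) :
    u.IsEquivalence := by
  subst h
  have faithful : u.Faithful := by
    refine ⟨fun {x x'} f g hfg => ?_⟩
    let o : CostructuredArrow (u ⋙ w) (w.obj (u.obj x')) :=
      CostructuredArrow.mk (Y := x) (w.map (u.map f))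
    let o' : CostructuredArrow (u ⋙ w) (w.obj (u.obj x')) :=
      CostructuredArrow.mk (Y := x') (𝟙 _)
    let f' : o ⟶ o' := CostructuredArrow.homMk f (by simp [o, o'])
    let g' : o ⟶ o' := CostructuredArrow.homMk g (by simp [o, o', hfg])
    have hfg' : f' = g' := (inducedSliceFunctor (u ⋙ w) w u rfl _).map_injective
      (CostructuredArrow.hom_ext _ _ hfg)
    exact congrArg (fun k : o ⟶ o' => k.left) hfg'
  have full : u.Full := by
    refine ⟨fun {x x'} k => ?_⟩
    let F := inducedSliceFunctor (u ⋙ w) w u rfl (w.obj (u.obj x'))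
    let o : CostructuredArrow (u ⋙ w) (w.obj (u.obj x')) :=
      CostructuredArrow.mk (Y := x) (w.map k)
    let o' : CostructuredArrow (u ⋙ w) (w.obj (u.obj x')) :=
      CostructuredArrow.mk (Y := x') (𝟙 _)
    let k' : F.obj o ⟶ F.obj o' := CostructuredArrow.homMk k (by
      change w.map k ≫ 𝟙 _ ≫ 𝟙 _ = 𝟙 _ ≫ w.map k
      simp)
    obtain ⟨l, hl⟩ := F.map_surjective k'
    exact ⟨l.left, congrArg (fun m : F.obj o ⟶ F.obj o' => m.left) hl⟩
  have essSurj : u.EssSurj := by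
    refine ⟨fun y => ?_⟩
    let F := inducedSliceFunctor (u ⋙ w) w u rfl (w.obj y)
    let t : CostructuredArrow w (w.obj y) := CostructuredArrow.mk (𝟙 _)
    exact ⟨(F.objPreimage t).left, ⟨(CostructuredArrow.proj w _).mapIso (F.objObjPreimageIso t)⟩⟩
  exact { }
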